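/- Let α ∈ (0,1) be a Liouville number. For every r ∈ ℕ there exists a lift f of an orientation-preserving C^∞ circle diffeomorphism with rotation number ρ(f) = α such that d_r(f, R_α) < 2^{−r} and the circle diffeomorphism induced by f has ratio set r(f) = [0, ∞) (i.e. it is of type III_∞). -/

import Mathlib

noncomputable section
open MeasureTheory Filter Topology

/-- A lift of an orientation-preserving `C^∞` circle diffeomorphism: a `C^∞` map
`f : ℝ → ℝ` with `f (x+1) = f x + 1` and everywhere positive derivative. -/
def IsCircleDiffeoLift (f : ℝ → ℝ) : Prop :=
  ContDiff ℝ (⊤ : ℕ∞) f ∧ (∀ x : ℝ, f (x + 1) = f x + 1) ∧ ∀ x : ℝ, 0 < deriv f x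

/-- The `C^r` norm `‖φ‖_r = max_{0 ≤ i ≤ r} sup_x |φ^{(i)}(x)|`. -/
def CrNorm (r : ℕ) (φ : ℝ → ℝ) : ℝ :=
  (Finset.range (r + 1)).sup' (Finset.nonempty_range_iff.mpr r.succ_ne_zero)
    fun i => ⨆ x : ℝ, |iteratedDeriv i φ x|

/-- `d_r(f, g) = max {‖f - g‖_r, ‖f⁻¹ - g⁻¹‖_r}`. -/
def liftDist (r : ℕ) (f g : ℝ → ℝ) : ℝ :=
  max (CrNorm r (fun x => f x - g x))
    (CrNorm r (fun x => Function.invFun f x - Function.invFun g x))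

/-- `|f|_r = max {‖f - id‖_r, ‖f⁻¹ - id‖_r, 1}`. -/
def liftNorm (r : ℕ) (f : ℝ → ℝ) : ℝ :=
  max (max (CrNorm r (fun x => f x - x)) (CrNorm r (fun x => Function.invFun f x - x))) 1

/-- The lift `x ↦ x + a` of the rotation by `a`. -/
def RotLift (a : ℝ) : ℝ → ℝ := fun x => x + a

/-- The rotation number of the circle diffeomorphism induced by the lift `f` equals `a`
(mod 1): the translation number `lim (fⁿ(0) - 0)/n` equals `a + k` for some integer `k`. -/
def HasRotationNumber (f : ℝ → ℝ) (a : ℝ) : Prop :=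
  ∃ k : ℤ, Tendsto (fun n : ℕ => f^[n] 0 / (n : ℝ)) atTop (nhds (a + k))

/-- The lift of the `i`-th iterate (`i ∈ ℤ`) of the circle diffeomorphism induced by `f`. -/
def zpowLift (f : ℝ → ℝ) : ℤ → ℝ → ℝ := fun i =>
  if 0 ≤ i then f^[i.toNat] else (Function.invFun f)^[(-i).toNat]

/-- The ratio set of a circle diffeomorphism, described through the family `Fz i` of its
iterates (`i ∈ ℤ`) and the family `D i` of the derivatives of its iterates: `t ≥ 0` lies in
the ratio set iff for every Borel `A` of positive Haar measure and every `ε > 0` there are a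
Borel `B ⊆ A` of positive measure and `i ∈ ℤ` with `Fz i '' B ⊆ A` and `|D i x - t| < ε`
on `B`. -/
def ratioSet (Fz : ℤ → UnitAddCircle → UnitAddCircle) (D : ℤ → UnitAddCircle → ℝ) : Set ℝ :=
  {t : ℝ | 0 ≤ t ∧ ∀ A : Set UnitAddCircle, MeasurableSet A → 0 < volume A →
    ∀ ε : ℝ, 0 < ε → ∃ B : Set UnitAddCircle, MeasurableSet B ∧ B ⊆ A ∧ 0 < volume B ∧
      ∃ i : ℤ, Fz i '' B ⊆ A ∧ ∀ x ∈ B, |D i x - t| < ε}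

/-- A lift of an orientation-preserving `C¹` circle diffeomorphism. -/
def IsC1CircleLift (f : ℝ → ℝ) : Prop :=
  ContDiff ℝ 1 f ∧ (∀ x : ℝ, f (x + 1) = f x + 1) ∧ ∀ x : ℝ, 0 < deriv f x

open scoped ContDiff

/-- All derivatives of `f` of order at most `r` are bounded by `M`. -/
def DerivBound (r : ℕ) (M : ℝ) (f : ℝ → ℝ) : Prop :=
  ∀ k ≤ r, ∀ x, |iteratedDeriv k f x| ≤ M

/-- A smooth function all of whose derivatives of positive order are bounded. -/
def BoundedDerivs (f : ℝ → ℝ) : Prop :=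
  ContDiff ℝ ∞ f ∧ ∀ k : ℕ, ∃ C, 0 ≤ C ∧ ∀ x, |iteratedDeriv (k + 1) f x| ≤ C

theorem ContDiff.deriv_infty {f : ℝ → ℝ} (hf : ContDiff ℝ ∞ f) : ContDiff ℝ ∞ (deriv f) :=
  (contDiff_infty_iff_deriv.1 hf).2

theorem ContDiff.differentiable_infty {f : ℝ → ℝ} (hf : ContDiff ℝ ∞ f) : Differentiable ℝ f :=
  (contDiff_infty_iff_deriv.1 hf).1

theorem ContDiff.of_infty {f : ℝ → ℝ} (hf : ContDiff ℝ ∞ f) (k : ℕ) : ContDiff ℝ k f :=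
  contDiff_infty.1 hf k

namespace DerivBound

variable {r : ℕ} {M N : ℝ} {f g : ℝ → ℝ}

theorem zero_iff : DerivBound 0 M f ↔ ∀ x, |f x| ≤ M := by
  simp [DerivBound]

theorem succ_iff : DerivBound (r + 1) M f ↔ (∀ x, |f x| ≤ M) ∧ DerivBound r M (deriv f) := by
  constructor
  · intro h
    refine ⟨fun x => by simpa using h 0 (by omega) x, fun k hk x => ?_⟩
    rw [← iteratedDeriv_succ']
    exact h (k + 1) (by omega) x
  · rintro ⟨h0, h1⟩ k hk x
    cases k with
    | zero => simpa using h0 x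
    | succ k => rw [iteratedDeriv_succ']; exact h1 k (by omega) x

theorem abs_le (h : DerivBound r M f) (x : ℝ) : |f x| ≤ M := by
  simpa using h 0 (by omega) x

theorem nonneg (h : DerivBound r M f) : 0 ≤ M := (abs_nonneg _).trans (h.abs_le 0)

theorem mono (h : DerivBound r M f) (hMN : M ≤ N) : DerivBound r N f :=
  fun k hk x => (h k hk x).trans hMN

theorem of_le {r' : ℕ} (h : DerivBound r M f) (hr : r' ≤ r) : DerivBound r' M f :=
  fun k hk x => h k (hk.trans hr) x

theorem add (hf : ContDiff ℝ ∞ f) (hg : ContDiff ℝ ∞ g) (h : DerivBound r M f)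
    (h' : DerivBound r N g) : DerivBound r (M + N) (fun x => f x + g x) := by
  intro k hk x
  rw [iteratedDeriv_fun_add (hf.of_infty k).contDiffAt (hg.of_infty k).contDiffAt]
  exact (abs_add_le _ _).trans (add_le_add (h k hk x) (h' k hk x))

theorem mul (hf : ContDiff ℝ ∞ f) (hg : ContDiff ℝ ∞ g) (h : DerivBound r M f)
    (h' : DerivBound r N g) : DerivBound r (2 ^ r * (M * N)) (fun x => f x * g x) := by
  induction r generalizing f g with
  | zero =>
    rw [zero_iff] at *
    intro x
    rw [abs_mul, pow_zero, one_mul]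
    exact mul_le_mul (h x) (h' x) (abs_nonneg _) ((abs_nonneg _).trans (h x))
  | succ r ih =>
    have hM := h.nonneg
    have hN := h'.nonneg
    rw [succ_iff]
    constructor
    · intro x
      rw [abs_mul]
      calc |f x| * |g x| ≤ 1 * (M * N) := by
            rw [one_mul]; exact mul_le_mul (h.abs_le x) (h'.abs_le x) (abs_nonneg _) hM
        _ ≤ _ := mul_le_mul_of_nonneg_right (one_le_pow₀ (by norm_num)) (mul_nonneg hM hN)
    · have hd : deriv (fun x => f x * g x) = fun x => deriv f x * g x + f x * deriv g x := by
        ext x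
        exact deriv_fun_mul (hf.differentiable_infty x) (hg.differentiable_infty x)
      rw [hd]
      have h1 := ih hf.deriv_infty hg (succ_iff.1 h).2 (h'.of_le r.le_succ)
      have h2 := ih hf hg.deriv_infty (h.of_le r.le_succ) (succ_iff.1 h').2
      refine (DerivBound.add (hf.deriv_infty.mul hg) (hf.mul hg.deriv_infty) h1 h2).mono ?_
      rw [pow_succ]; linarith

end DerivBound

theorem BoundedDerivs.deriv {f : ℝ → ℝ} (h : BoundedDerivs f) : BoundedDerivs (deriv f) :=
  ⟨h.1.deriv_infty, fun k => by
    obtain ⟨C, hC, hb⟩ := h.2 (k + 1)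
    exact ⟨C, hC, fun x => by rw [← iteratedDeriv_succ']; exact hb x⟩⟩

theorem BoundedDerivs.derivBound {f : ℝ → ℝ} (h : BoundedDerivs f) (r : ℕ) :
    ∃ C, 0 ≤ C ∧ DerivBound r C (_root_.deriv f) := by
  induction r with
  | zero =>
    obtain ⟨C, hC, hb⟩ := h.2 0
    exact ⟨C, hC, DerivBound.zero_iff.2 fun x => by simpa [iteratedDeriv_one] using hb x⟩
  | succ r ih =>
    obtain ⟨C, hC, hb⟩ := ih
    obtain ⟨C', hC', hb'⟩ := h.2 (r + 1)
    refine ⟨max C C', le_max_of_le_left hC, fun k hk x => ?_⟩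
    rcases Nat.le_succ_iff.1 hk with hk | rfl
    · exact (hb k hk x).trans (le_max_left _ _)
    · rw [← iteratedDeriv_succ']
      exact (hb' x).trans (le_max_right _ _)

theorem BoundedDerivs.lipschitz {f : ℝ → ℝ} (h : BoundedDerivs f) :
    ∃ C, 0 ≤ C ∧ ∀ x y, |f y - f x| ≤ C * |y - x| := by
  obtain ⟨C, hC, hb⟩ := h.derivBound 0
  refine ⟨C, hC, fun x y => ?_⟩
  exact Convex.norm_image_sub_le_of_norm_deriv_le (s := Set.univ)
    (fun x _ => h.1.differentiable_infty x) (fun x _ => hb.abs_le x) convex_univ trivial trivial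

/-- Precomposition with a fixed map is bounded for the `C^r` norms. -/
theorem BoundedDerivs.derivBound_comp {K : ℝ → ℝ} (hK : BoundedDerivs K) (r : ℕ) :
    ∃ C, 0 ≤ C ∧ ∀ W M, ContDiff ℝ ∞ W → DerivBound r M W →
      DerivBound r (C * M) (fun x => W (K x)) := by
  induction r with
  | zero =>
    refine ⟨1, zero_le_one, fun W M _ hb => ?_⟩
    rw [DerivBound.zero_iff] at *
    intro x
    rw [one_mul]
    exact hb _
  | succ r ih =>
    obtain ⟨C, hC, hc⟩ := ih
    obtain ⟨D, hD, hd⟩ := hK.derivBound r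
    refine ⟨1 + 2 ^ r * (C * D), by positivity, fun W M hW hb => ?_⟩
    have hM := hb.nonneg
    have hE : 0 ≤ 2 ^ r * (C * D) := by positivity
    rw [DerivBound.succ_iff]
    constructor
    · intro x
      exact (hb.abs_le _).trans (by nlinarith)
    · have : _root_.deriv (fun x => W (K x)) = fun x => _root_.deriv W (K x) * _root_.deriv K x := by
        ext x
        exact deriv_comp (h₂ := W) x (hW.differentiable_infty _) (hK.1.differentiable_infty x)
      rw [this]
      have h1 := hc _ M hW.deriv_infty (DerivBound.succ_iff.1 hb).2
      refine (DerivBound.mul (hW.deriv_infty.comp hK.1) hK.1.deriv_infty h1 hd).mono ?_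
      nlinarith

/-- Postcomposition with a fixed map is locally Lipschitz for the `C^r` norms at a translation. -/
theorem BoundedDerivs.derivBound_perturb (r : ℕ) {H : ℝ → ℝ} (hH : BoundedDerivs H) (β : ℝ) :
    ∃ C, 0 ≤ C ∧ ∀ φ M, M ≤ 1 → ContDiff ℝ ∞ φ → DerivBound r M φ →
      DerivBound r (C * M) (fun u => H (u + β + φ u) - H (u + β)) := by
  induction r generalizing H with
  | zero =>
    obtain ⟨C, hC, hL⟩ := hH.lipschitz
    refine ⟨C, hC, fun φ M _ _ hb => ?_⟩
    rw [DerivBound.zero_iff] at *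
    intro x
    refine (hL _ _).trans (mul_le_mul_of_nonneg_left ?_ hC)
    simpa using hb x
  | succ r ih =>
    obtain ⟨C, hC, hL⟩ := hH.lipschitz
    obtain ⟨D, hD, hd⟩ := ih hH.deriv
    obtain ⟨E, hE, he⟩ := hH.derivBound r
    refine ⟨C + (D + 2 ^ r * D + 2 ^ r * E), by positivity, fun φ M hM1 hφ hb => ?_⟩
    have hM := hb.nonneg
    have hDE : 0 ≤ D + 2 ^ r * D + 2 ^ r * E := by positivity
    rw [DerivBound.succ_iff]
    constructor
    · intro x
      refine (hL _ _).trans ?_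
      have : |x + β + φ x - (x + β)| ≤ M := by simpa using hb.abs_le x
      nlinarith
    · have hH' := hH.1.deriv_infty
      set W : ℝ → ℝ := fun u => _root_.deriv H (u + β + φ u) - _root_.deriv H (u + β) with hW
      have hsh : ContDiff ℝ ∞ fun u : ℝ => _root_.deriv H (u + β) :=
        hH'.comp (contDiff_id.add contDiff_const)
      have hWs : ContDiff ℝ ∞ W :=
        (hH'.comp ((contDiff_id.add contDiff_const).add hφ)).sub hsh
      have hder : _root_.deriv (fun u => H (u + β + φ u) - H (u + β)) =
          fun u => (W u + W u * _root_.deriv φ u) + _root_.deriv H (u + β) * _root_.deriv φ u := by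
        ext u
        have hHd := hH.1.differentiable_infty
        have h1 : HasDerivAt (fun u => u + β + φ u) (1 + _root_.deriv φ u) u :=
          ((hasDerivAt_id u).add_const β).add (hφ.differentiable_infty u).hasDerivAt
        have h2 : HasDerivAt (fun u => u + β) 1 u := (hasDerivAt_id u).add_const β
        have h3 := ((hHd (u + β + φ u)).hasDerivAt.comp u h1).sub
          ((hHd (u + β)).hasDerivAt.comp u h2)
        refine h3.deriv.trans ?_
        simp only [hW]; ring
      rw [hder]
      have hφ1 := (DerivBound.succ_iff.1 hb).2
      have b1 := hd φ M hM1 hφ (hb.of_le r.le_succ)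
      have b2 := DerivBound.mul hWs hφ.deriv_infty b1 hφ1
      have b3 : DerivBound r E fun u : ℝ => _root_.deriv H (u + β) := by
        intro k hk x
        rw [iteratedDeriv_comp_add_const]
        exact he k hk _
      have b4 := DerivBound.mul hsh hφ.deriv_infty b3 hφ1
      have b5 := DerivBound.add (hWs.add (hWs.mul hφ.deriv_infty)) (hsh.mul hφ.deriv_infty)
        (DerivBound.add hWs (hWs.mul hφ.deriv_infty) b1 b2) b4
      refine b5.mono ?_
      have hDM : D * M * M ≤ D * M := by
        nlinarith [mul_nonneg hD hM]
      have : (2 : ℝ) ^ r * (D * M * M) ≤ 2 ^ r * (D * M) :=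
        mul_le_mul_of_nonneg_left hDM (by positivity)
      nlinarith [mul_nonneg hC hM]

theorem BoundedDerivs.of_map_add_one {f : ℝ → ℝ} (hf : ContDiff ℝ ∞ f)
    (h1 : ∀ x, f (x + 1) = f x + 1) : BoundedDerivs f := by
  refine ⟨hf, fun k => ?_⟩
  have hp : Function.Periodic (iteratedDeriv (k + 1) f) 1 := by
    intro x
    have h2 := congrFun (iteratedDeriv_comp_add_const (k + 1) f 1) x
    rw [← h2]
    simp only [h1, add_comm (f _) 1]
    rw [iteratedDeriv_const_add k.succ_pos]
  have hc : Continuous (iteratedDeriv (k + 1) f) :=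
    (hf.of_infty (k + 1)).continuous_iteratedDeriv' (k + 1)
  obtain ⟨C, hC⟩ := (hp.compact_of_continuous one_ne_zero hc).isBounded.exists_norm_le
  exact ⟨C, (norm_nonneg _).trans (hC _ ⟨0, rfl⟩), fun x => hC _ ⟨x, rfl⟩⟩

/-- A smooth lift of an orientation-preserving circle diffeomorphism together with its inverse. -/
structure CircleLift where
  toFun : ℝ → ℝ
  inv : ℝ → ℝ
  smooth : ContDiff ℝ ∞ toFun
  inv_smooth : ContDiff ℝ ∞ inv
  map_add_one : ∀ x, toFun (x + 1) = toFun x + 1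
  strictMono : StrictMono toFun
  left_inv : ∀ x, inv (toFun x) = x
  right_inv : ∀ x, toFun (inv x) = x

namespace CircleLift

variable (H G : CircleLift)

theorem inv_add_one (x : ℝ) : H.inv (x + 1) = H.inv x + 1 := by
  conv_lhs => rw [← H.right_inv x, ← H.map_add_one, H.left_inv]

theorem inv_strictMono : StrictMono H.inv := by
  intro x y hxy
  rw [← H.right_inv x, ← H.right_inv y] at hxy
  exact H.strictMono.lt_iff_lt.1 hxy

theorem map_add_nat (x : ℝ) (n : ℕ) : H.toFun (x + n) = H.toFun x + n := by
  induction n with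
  | zero => simp
  | succ n ih => push_cast; rw [← add_assoc, map_add_one, ih, add_assoc]

theorem map_add_int (x : ℝ) (n : ℤ) : H.toFun (x + n) = H.toFun x + n := by
  obtain ⟨k, rfl | rfl⟩ := n.eq_nat_or_neg
  · exact_mod_cast H.map_add_nat x k
  · have := H.map_add_nat (x + -k) k
    push_cast
    rw [neg_add_cancel_right] at this
    linarith

theorem differentiable : Differentiable ℝ H.toFun := H.smooth.differentiable_infty

theorem boundedDerivs : BoundedDerivs H.toFun := .of_map_add_one H.smooth H.map_add_one

theorem inv_boundedDerivs : BoundedDerivs H.inv := .of_map_add_one H.inv_smooth H.inv_add_one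

theorem deriv_inv_mul (x : ℝ) : deriv H.inv (H.toFun x) * deriv H.toFun x = 1 := by
  have h := ((H.inv_smooth.differentiable_infty (H.toFun x)).hasDerivAt.comp x
    (H.differentiable x).hasDerivAt)
  have h2 : H.inv ∘ H.toFun = id := funext H.left_inv
  rw [h2] at h
  exact h.unique (hasDerivAt_id x)

theorem deriv_pos (x : ℝ) : 0 < deriv H.toFun x := by
  refine lt_of_le_of_ne H.strictMono.monotone.deriv_nonneg fun h => ?_
  have := H.deriv_inv_mul x
  rw [← h, mul_zero] at this
  exact zero_ne_one this

theorem exists_le_deriv : ∃ μ > 0, ∀ x, μ ≤ deriv H.toFun x := by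
  obtain ⟨C, hC, hb⟩ := H.inv_boundedDerivs.derivBound 0
  refine ⟨1 / (C + 1), by positivity, fun x => ?_⟩
  have h1 := H.deriv_inv_mul x
  have h2 := (abs_le.1 (hb.abs_le (H.toFun x))).2
  have h3 := H.deriv_pos x
  rw [div_le_iff₀ (by positivity)]
  nlinarith

/-- The identity. -/
def refl : CircleLift where
  toFun := id
  inv := id
  smooth := contDiff_id
  inv_smooth := contDiff_id
  map_add_one _ := rfl
  strictMono := strictMono_id
  left_inv _ := rfl
  right_inv _ := rfl

/-- Composition of lifts. -/
def comp : CircleLift where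
  toFun x := H.toFun (G.toFun x)
  inv x := G.inv (H.inv x)
  smooth := H.smooth.comp G.smooth
  inv_smooth := G.inv_smooth.comp H.inv_smooth
  map_add_one x := by rw [G.map_add_one, H.map_add_one]
  strictMono := H.strictMono.comp G.strictMono
  left_inv x := by rw [H.left_inv, G.left_inv]
  right_inv x := by rw [G.right_inv, H.right_inv]

/-- The lift of `H` under the `q`-fold covering of the circle by itself. -/
def scale (q : ℕ) (hq : 0 < q) : CircleLift where
  toFun x := H.toFun (q * x) / q
  inv x := H.inv (q * x) / q
  smooth := (H.smooth.comp (contDiff_const.mul contDiff_id)).div_const _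
  inv_smooth := (H.inv_smooth.comp (contDiff_const.mul contDiff_id)).div_const _
  map_add_one x := by
    rw [mul_add, mul_one, H.map_add_nat, add_div, div_self (by positivity)]
  strictMono x y hxy := by
    have : (0 : ℝ) < q := by exact_mod_cast hq
    exact div_lt_div_of_pos_right (H.strictMono (mul_lt_mul_of_pos_left hxy this)) this
  left_inv x := by
    have : (q : ℝ) ≠ 0 := by exact_mod_cast hq.ne'
    rw [mul_div_cancel₀ _ this, H.left_inv, mul_div_cancel_left₀ _ this]
  right_inv x := by
    have : (q : ℝ) ≠ 0 := by exact_mod_cast hq.ne'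
    rw [mul_div_cancel₀ _ this, H.right_inv, mul_div_cancel_left₀ _ this]

/-- The conjugate by `H` of the translation by `β`. -/
def conj (β : ℝ) : ℝ → ℝ := fun x => H.toFun (H.inv x + β)

theorem conj_zero (x : ℝ) : H.conj 0 x = x := by simp [conj, H.right_inv]

theorem conj_conj (β γ x : ℝ) : H.conj β (H.conj γ x) = H.conj (γ + β) x := by
  simp [conj, H.left_inv, add_assoc]

theorem conj_smooth (β : ℝ) : ContDiff ℝ ∞ (H.conj β) :=
  H.smooth.comp (H.inv_smooth.add contDiff_const)

theorem conj_add_one (β x : ℝ) : H.conj β (x + 1) = H.conj β x + 1 := by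
  simp only [conj, inv_add_one]
  rw [← H.map_add_one]; ring_nf

theorem conj_strictMono (β : ℝ) : StrictMono (H.conj β) := fun _ _ h =>
  H.strictMono (add_lt_add_left (H.inv_strictMono h) β)

theorem deriv_conj (β s : ℝ) :
    deriv (H.conj β) (H.toFun s) = deriv H.toFun (s + β) / deriv H.toFun s := by
  have h : HasDerivAt (H.conj β)
      (deriv H.toFun (H.inv (H.toFun s) + β) * deriv H.inv (H.toFun s)) (H.toFun s) :=
    (H.differentiable _).hasDerivAt.comp _
      ((H.inv_smooth.differentiable_infty _).hasDerivAt.add_const β)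
  rw [h.deriv, H.left_inv, eq_div_iff (H.deriv_pos s).ne', mul_assoc, H.deriv_inv_mul, mul_one]

/-- Translation number estimate for a conjugate of a translation. -/
theorem abs_conj_sub_le (β : ℝ) : |H.conj β 0 - β| ≤ 1 := by
  have key : ∀ y z : ℝ, |H.toFun z - H.toFun y - (z - y)| ≤ 1 := by
    intro y z
    have h1 : (⌊z - y⌋ : ℝ) ≤ z - y := Int.floor_le _
    have h2 : z - y < ⌊z - y⌋ + 1 := Int.lt_floor_add_one _
    have h3 : H.toFun (y + ⌊z - y⌋) ≤ H.toFun z := H.strictMono.monotone (by linarith)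
    have h4 : H.toFun z ≤ H.toFun (y + ⌊z - y⌋ + 1) := H.strictMono.monotone (by linarith)
    rw [H.map_add_one] at h4
    rw [H.map_add_int] at h3 h4
    rw [abs_le]
    constructor <;> linarith
  have := key (H.inv 0) (H.inv 0 + β)
  rw [H.right_inv] at this
  simpa [conj] using this

/-- Conjugating by a highly periodic lift barely changes the translations which are close to
multiples of its period. -/
theorem derivBound_conj_sub (r : ℕ) (α : ℝ) (i : ℤ) :
    ∃ C D, 0 ≤ C ∧ 0 ≤ D ∧ ∀ (q : ℕ) (hq : 0 < q) (p : ℤ),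
      D * (q ^ (r + 1) * |α - p / q|) ≤ 1 →
      DerivBound r (C * (q ^ (r + 1) * |α - p / q|))
        (fun x => (H.comp (G.scale q hq)).conj (i * α) x - H.conj (i * α) x) := by
  obtain ⟨C₁, hC₁, h₁⟩ := H.boundedDerivs.derivBound_perturb r (i * α)
  obtain ⟨C₂, hC₂, h₂⟩ := H.inv_boundedDerivs.derivBound_comp r
  obtain ⟨C₃, hC₃, h₃⟩ := G.inv_boundedDerivs.derivBound_comp r
  set P : ℝ → ℝ := fun x => G.toFun x - x with hP
  have hPs : ContDiff ℝ ∞ P := G.smooth.sub contDiff_id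
  have hPp : ∀ (x : ℝ) (n : ℤ), P (x + n) = P x := fun x n => by
    simp only [hP, G.map_add_int]; ring
  have hPB : ∃ C, 0 ≤ C ∧ DerivBound r C (deriv P) := by
    obtain ⟨C, hC, hb⟩ := G.boundedDerivs.derivBound r
    have hd : deriv P = fun x => deriv G.toFun x + (-1) := by
      ext x
      have := (G.differentiable x).hasDerivAt.sub (hasDerivAt_id x)
      rw [← sub_eq_add_neg]
      exact this.deriv
    have h1 : DerivBound r 1 fun _ : ℝ => (-1 : ℝ) := by
      intro k _ x
      rw [iteratedDeriv_const]
      split_ifs <;> simp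
    exact ⟨C + 1, by positivity, hd ▸ DerivBound.add G.smooth.deriv_infty contDiff_const hb h1⟩
  obtain ⟨C₄, hC₄, h₄⟩ := hPB
  have hshift : ∀ s, DerivBound r (C₄ * |s|) (fun z => P (z + s) - P z) := by
    intro s k hk x
    have hs1 : ContDiff ℝ ∞ fun z => P (z + s) := hPs.comp (contDiff_id.add contDiff_const)
    rw [iteratedDeriv_fun_sub (hs1.of_infty k).contDiffAt (hPs.of_infty k).contDiffAt,
      iteratedDeriv_comp_add_const]
    have := Convex.norm_image_sub_le_of_norm_deriv_le (s := Set.univ) (C := C₄) (x := x)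
      (y := x + s) (f := iteratedDeriv k P)
      (fun x _ => (hPs.of_infty (k + 1)).differentiable_iteratedDeriv k
        (by exact_mod_cast k.lt_succ_self) x)
      (fun x _ => by rw [← iteratedDeriv_succ, iteratedDeriv_succ']; exact h₄ k hk x)
      convex_univ trivial trivial
    simpa using this
  refine ⟨C₂ * (C₁ * (C₃ * (C₄ * |(i : ℝ)|))), C₃ * (C₄ * |(i : ℝ)|), by positivity,
    by positivity, fun q hq p hsmall => ?_⟩
  have hq0 : (0 : ℝ) < q := by exact_mod_cast hq
  have hq1 : (1 : ℝ) ≤ q := by exact_mod_cast hq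
  set s : ℝ := i * (q * (α - p / q)) with hs
  set V : ℝ → ℝ := fun z => P (G.inv z + s) - P (G.inv z) with hV
  have hVs : ContDiff ℝ ∞ V :=
    (hPs.comp (G.inv_smooth.add contDiff_const)).sub (hPs.comp G.inv_smooth)
  have hVb : DerivBound r (C₃ * (C₄ * |s|)) V :=
    h₃ (fun z => P (z + s) - P z) _
      ((hPs.comp (contDiff_id.add contDiff_const)).sub hPs) (hshift s)
  set φ : ℝ → ℝ := fun u => (q : ℝ)⁻¹ * V (q * u) with hφ
  have hφs : ContDiff ℝ ∞ φ := contDiff_const.mul (hVs.comp (contDiff_const.mul contDiff_id))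
  have hM : C₃ * (C₄ * |(i : ℝ)|) * (q ^ (r + 1) * |α - p / q|)
      = q ^ r * (C₃ * (C₄ * |s|)) := by
    rw [hs, abs_mul, abs_mul, abs_of_pos hq0, pow_succ]; ring
  have hφb : DerivBound r (C₃ * (C₄ * |(i : ℝ)|) * (q ^ (r + 1) * |α - p / q|)) φ := by
    rw [hM]
    intro k hk x
    rw [hφ, iteratedDeriv_const_mul_field, iteratedDeriv_comp_const_mul (hVs.of_infty k),
      abs_mul, abs_mul, abs_of_pos (inv_pos.2 hq0), abs_of_pos (pow_pos hq0 k)]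
    have e1 : (q : ℝ)⁻¹ ≤ 1 := inv_le_one_of_one_le₀ hq1
    have e2 : (q : ℝ) ^ k ≤ q ^ r := pow_le_pow_right₀ hq1 hk
    have e3 := hVb k hk (q * x)
    calc (q : ℝ)⁻¹ * (q ^ k * |iteratedDeriv k V (q * x)|)
        ≤ 1 * (q ^ r * (C₃ * (C₄ * |s|))) := by gcongr
      _ = _ := one_mul _
  have hW := h₂ _ _ (((H.smooth.comp ((contDiff_id.add contDiff_const).add hφs)).sub
    (H.smooth.comp (contDiff_id.add contDiff_const)))) (h₁ φ _ hsmall hφs hφb)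
  have hfun : (fun x => (H.comp (G.scale q hq)).conj (i * α) x - H.conj (i * α) x) =
      fun x => H.toFun (H.inv x + i * α + φ (H.inv x)) - H.toFun (H.inv x + i * α) := by
    ext x
    simp only [conj, comp, scale]
    congr 2
    set u := H.inv x
    set k := G.inv (q * u) with hk
    have e1 : (q : ℝ) * (k / q + i * α) = k + s + ((i * p : ℤ) : ℝ) := by
      rw [hs]; push_cast; field_simp; ring
    have e2 : G.toFun k = q * u := G.right_inv _
    have e3 := hPp (k + s) (i * p)
    rw [← e1] at e3
    simp only [hφ, hV, ← hk]
    rw [← e3]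
    simp only [hP, e2]
    field_simp
    ring
  rw [hfun]
  convert hW using 1
  · ring
  · rfl
end CircleLift

/-- A sequence of very good rational approximations of `α`. -/
structure LiouvilleApprox (α : ℝ) where
  num : ℕ → ℤ
  den : ℕ → ℕ
  den_pos : ∀ m, 0 < den m
  le_den : ∀ m, m ≤ den m
  abs_sub_le : ∀ m, |α - num m / den m| ≤ 1 / (den m : ℝ) ^ m

theorem Liouville.nonempty_approx {α : ℝ} (h : Liouville α) : Nonempty (LiouvilleApprox α) := by
  have : ∀ m : ℕ, ∃ q : ℕ, ∃ p : ℤ, 0 < q ∧ m ≤ q ∧ |α - p / q| ≤ 1 / (q : ℝ) ^ m := by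
    intro m
    obtain ⟨q, hq, p, -, hp⟩ := frequently_atTop.1 (h.frequently_exists_num m) (m + 1)
    exact ⟨q, p, by omega, by omega, hp.le⟩
  choose q p h1 h2 h3 using this
  exact ⟨⟨p, q, h1, h2, h3⟩⟩

namespace CircleLift

theorem eventually_derivBound_conj_sub {α : ℝ} (A : LiouvilleApprox α) (H G : CircleLift)
    (r : ℕ) (i : ℤ) {ε : ℝ} (hε : 0 < ε) :
    ∀ᶠ m in atTop, DerivBound r ε
      (fun x => (H.comp (G.scale (A.den m) (A.den_pos m))).conj (i * α) x
        - H.conj (i * α) x) := by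
  obtain ⟨C, D, hC, hD, h⟩ := H.derivBound_conj_sub G r α i
  obtain ⟨N, hN⟩ := exists_nat_gt (max (C / ε) D)
  filter_upwards [eventually_ge_atTop (max (r + 2) (max N 1))] with m hm
  have hmr : r + 2 ≤ m := (le_max_left _ _).trans hm
  have hmN : N ≤ m := ((le_max_left _ _).trans (le_max_right _ _)).trans hm
  set q := A.den m with hq
  have hq0 : (0 : ℝ) < q := by exact_mod_cast A.den_pos m
  have hq1 : (1 : ℝ) ≤ q := by exact_mod_cast A.den_pos m
  have hqN : max (C / ε) D < q :=
    hN.trans_le (by exact_mod_cast hmN.trans (A.le_den m))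
  have hδ : (q : ℝ) ^ (r + 1) * |α - A.num m / q| ≤ 1 / q := by
    calc (q : ℝ) ^ (r + 1) * |α - A.num m / q| ≤ q ^ (r + 1) * (1 / (q : ℝ) ^ m) := by
          gcongr; exact A.abs_sub_le m
      _ ≤ q ^ (r + 1) * (1 / (q : ℝ) ^ (r + 2)) := by gcongr
      _ = 1 / q := by field_simp; ring
  have h1 : C ≤ ε * q := by
    have := ((le_max_left _ _).trans_lt hqN)
    rw [div_lt_iff₀ hε] at this
    linarith
  have h2 : D ≤ q := ((le_max_right _ _).trans_lt hqN).le
  refine (h q (A.den_pos m) (A.num m) ?_).mono ?_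
  · calc D * (q ^ (r + 1) * |α - A.num m / q|) ≤ D * (1 / q) := by gcongr
      _ ≤ q * (1 / q) := by gcongr
      _ = 1 := by field_simp
  · calc C * (q ^ (r + 1) * |α - A.num m / q|) ≤ C * (1 / q) := by gcongr
      _ ≤ ε * q * (1 / q) := by gcongr
      _ = ε := by field_simp

end CircleLift

theorem exists_int_mul_near {α : ℝ} (hα : Irrational α) (s : ℝ) {κ : ℝ} (hκ : 0 < κ) :
    ∃ i p : ℤ, |i * α - p - s| ≤ κ := by
  have hd : Dense (AddSubgroup.closure {α, (1 : ℝ)} : Set ℝ) :=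
    dense_addSubgroupClosure_pair_iff.2 (by simpa using hα)
  obtain ⟨y, hy, hy'⟩ := hd.exists_dist_lt s hκ
  obtain ⟨a, b, hab⟩ := AddSubgroup.mem_closure_pair.1 hy
  refine ⟨a, -b, ?_⟩
  rw [dist_comm, Real.dist_eq, ← hab] at hy'
  simpa using hy'.le

/-- The lift `y ↦ y + (a / 2π) (cos (2πy) - 1)`. -/
theorem exists_cosLift {a : ℝ} (ha : |a| < 1) : ∃ G : CircleLift,
    G.toFun 0 = 0 ∧ ∀ x, deriv G.toFun x = 1 - a * Real.sin (2 * Real.pi * x) := by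
  set g : ℝ → ℝ := fun y => y + a / (2 * Real.pi) * (Real.cos (2 * Real.pi * y) - 1) with hg
  have hpi : (2 * Real.pi) ≠ 0 := by positivity
  have hder : ∀ x, HasDerivAt g (1 - a * Real.sin (2 * Real.pi * x)) x := by
    intro x
    have h1 : HasDerivAt (fun y : ℝ => 2 * Real.pi * y) (2 * Real.pi) x := by
      simpa using (hasDerivAt_id x).const_mul (2 * Real.pi)
    have h2 := (hasDerivAt_id x).add (((h1.cos).sub_const 1).const_mul (a / (2 * Real.pi)))
    refine h2.congr_deriv ?_
    field_simp
    ring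
  have hpos : ∀ x, 0 < 1 - a * Real.sin (2 * Real.pi * x) := by
    intro x
    have h1 : |a * Real.sin (2 * Real.pi * x)| ≤ |a| := by
      rw [abs_mul]
      exact mul_le_of_le_one_right (abs_nonneg _) (Real.abs_sin_le_one _)
    linarith [(abs_le.1 h1).2]
  have hmono : StrictMono g := strictMono_of_hasDerivAt_pos hder hpos
  have hsm : ContDiff ℝ ∞ g := by
    refine contDiff_id.add (contDiff_const.mul (ContDiff.sub ?_ contDiff_const))
    exact Real.contDiff_cos.comp (contDiff_const.mul contDiff_id)
  have hadd : ∀ x, g (x + 1) = g x + 1 := by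
    intro x
    simp only [hg]
    rw [mul_add, mul_one, Real.cos_add_two_pi]; ring
  have hbd : ∀ x, |g x - x| ≤ |a / (2 * Real.pi)| * 2 := by
    intro x
    simp only [hg, add_sub_cancel_left, abs_mul]
    gcongr
    have h1 := Real.cos_le_one (2 * Real.pi * x)
    have h2 := Real.neg_one_le_cos (2 * Real.pi * x)
    rw [abs_le]; constructor <;> linarith
  have hsurj : Function.Surjective g := by
    refine hsm.continuous.surjective ?_ ?_
    · refine tendsto_atTop_mono (f := fun x => x + -(|a / (2 * Real.pi)| * 2)) (fun x => ?_)
        (tendsto_atTop_add_const_right _ _ tendsto_id)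
      linarith [(abs_le.1 (hbd x)).1]
    · refine tendsto_atBot_mono (f := fun x => x + |a / (2 * Real.pi)| * 2) (fun x => ?_)
        (tendsto_atBot_add_const_right _ _ tendsto_id)
      linarith [(abs_le.1 (hbd x)).2]
  let e := (hmono.orderIsoOfSurjective g hsurj).toHomeomorph
  refine ⟨⟨g, e.symm, hsm, e.contDiff_symm_deriv (fun x => (hpos x).ne') hder hsm, hadd, hmono,
    e.symm_apply_apply, e.apply_symm_apply⟩, by simp [hg], fun x => (hder x).deriv⟩

/-- Every point lies in a cell of radius at most `ρ` a definite proportion of which is mapped by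
`φ` into the same cell, with derivative close to `t`. -/
def HasGoodCells (φ : ℝ → ℝ) (t ε c ρ : ℝ) : Prop :=
  ∀ x, ∃ w δ u v, 0 < δ ∧ δ ≤ ρ ∧ x ∈ Metric.closedBall w δ ∧
    Set.Icc u v ⊆ Metric.closedBall w δ ∧ c * δ ≤ v - u ∧
    ∀ y ∈ Set.Icc u v, φ y ∈ Metric.closedBall w δ ∧ |deriv φ y - t| < ε

namespace CircleLift

variable (H : CircleLift)

theorem le_sub_of_le_deriv {μ : ℝ} (h : ∀ x, μ ≤ deriv H.toFun x) {x y : ℝ} (hxy : x ≤ y) :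
    μ * (y - x) ≤ H.toFun y - H.toFun x :=
  mul_sub_le_image_sub_of_le_deriv H.differentiable h hxy

end CircleLift

namespace CircleLift

/-- The derivative of a lift is nearly constant at small scales. -/
theorem exists_deriv_ratio (H : CircleLift) {κ : ℝ} (hκ : 0 < κ) :
    ∃ d > 0, ∀ x y, |y - x| ≤ d → |deriv H.toFun y / deriv H.toFun x - 1| ≤ κ := by
  obtain ⟨μ, hμ, hμ'⟩ := H.exists_le_deriv
  obtain ⟨L, hL, hL'⟩ := H.boundedDerivs.deriv.lipschitz
  refine ⟨κ * μ / (L + 1), by positivity, fun x y hxy => ?_⟩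
  have hx := H.deriv_pos x
  rw [div_sub_one hx.ne', abs_div, abs_of_pos hx, div_le_iff₀ hx]
  calc |deriv H.toFun y - deriv H.toFun x| ≤ L * |y - x| := hL' x y
    _ ≤ (L + 1) * (κ * μ / (L + 1)) := by gcongr; linarith
    _ = κ * μ := by field_simp
    _ ≤ κ * deriv H.toFun x := by gcongr; exact hμ' x

theorem exists_cosLift_goodCells {t ε : ℝ} (ht : 0 < t) (hε : 0 < ε) :
    ∃ G : CircleLift, ∃ c > 0, ∀ (H : CircleLift) (ρ : ℝ), 0 < ρ → ∃ Q : ℕ,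
      ∀ (q : ℕ) (hq : 0 < q), Q ≤ q → ∀ α : ℝ, Irrational α →
        ∃ i p : ℤ, ∃ η > 0, ∀ φ : ℝ → ℝ,
          (∀ x, |φ x - (H.comp (G.scale q hq)).conj (i * α) x| ≤ η) →
          (∀ x, |deriv φ x - deriv ((H.comp (G.scale q hq)).conj (i * α)) x| ≤ η) →
          HasGoodCells (fun x => φ x - p) t ε c ρ := by
  set a : ℝ := (t - 1) / (t + 1) with ha_def
  have ha : |a| < 1 := by
    rw [ha_def, abs_div, abs_of_pos (by linarith : 0 < t + 1), div_lt_one (by linarith), abs_lt]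
    constructor <;> linarith
  obtain ⟨G, hG0, hG⟩ := exists_cosLift ha
  set g : ℝ → ℝ := deriv G.toFun with hg
  have hgpos : ∀ x, 0 < g x := G.deriv_pos
  have hgper : ∀ (x : ℝ) (n : ℤ), g (x + n) = g x := by
    intro x n
    rw [hG, hG, mul_add, mul_comm (2 * Real.pi) (n : ℝ), Real.sin_add_int_mul_two_pi]
  have hgc : Continuous g := G.smooth.deriv_infty.continuous
  have hGint : ∀ n : ℤ, G.toFun n = n := fun n => by
    have := G.map_add_int 0 n
    rwa [zero_add, hG0, zero_add] at this
  have hval : g (3 / 4) / g (1 / 4) = t := by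
    have e1 : Real.sin (2 * Real.pi * (1 / 4)) = 1 := by
      have : 2 * Real.pi * (1 / 4) = Real.pi / 2 := by ring
      rw [this, Real.sin_pi_div_two]
    have e2 : Real.sin (2 * Real.pi * (3 / 4)) = -1 := by
      have : 2 * Real.pi * (3 / 4) = Real.pi / 2 + Real.pi := by ring
      rw [this, Real.sin_add_pi, Real.sin_pi_div_two]
    rw [hG, hG, e1, e2]
    have h1 : 1 - a * 1 = 2 / (t + 1) := by rw [ha_def]; field_simp; ring
    have h2 : 1 - a * -1 = 2 * t / (t + 1) := by rw [ha_def]; field_simp; ring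
    rw [h1, h2]; field_simp
  have hcont : ContinuousAt (fun z : ℝ × ℝ × ℝ => z.2.2 * (g z.2.1 / g z.1)) (1 / 4, 3 / 4, 1) := by
    have : Continuous fun z : ℝ × ℝ × ℝ => z.2.2 * (g z.2.1 / g z.1) :=
      continuous_snd.snd.mul ((hgc.comp continuous_snd.fst).div (hgc.comp continuous_fst)
        fun z => (hgpos _).ne')
    exact this.continuousAt
  obtain ⟨κ₀, hκ₀, hκ₀'⟩ := Metric.continuousAt_iff.1 hcont (ε / 2) (by positivity)
  set κ : ℝ := min (κ₀ / 4) (1 / 16) with hκ_def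
  have hκ : 0 < κ := by positivity
  have hκ16 : κ ≤ 1 / 16 := min_le_right _ _
  have hκκ : 4 * κ ≤ κ₀ := by linarith [min_le_left (κ₀ / 4) (1 / 16 : ℝ)]
  have hratio : ∀ z z' u, |z - 1 / 4| ≤ κ → |z' - 3 / 4| ≤ 2 * κ → |u - 1| ≤ κ →
      |u * (g z' / g z) - t| < ε / 2 := by
    intro z z' u h1 h2 h3
    have := @hκ₀' (z, z', u) (by
      simp only [Prod.dist_eq, Real.dist_eq]
      refine max_lt ?_ (max_lt ?_ ?_) <;> linarith)
    simp only [Real.dist_eq, one_mul, hval] at this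
    exact this
  obtain ⟨μ₀, hμ₀, hμ₀'⟩ := G.exists_le_deriv
  refine ⟨G, μ₀ * κ, by positivity, fun H ρ hρ => ?_⟩
  obtain ⟨d, hd, hd'⟩ := H.exists_deriv_ratio hκ
  obtain ⟨B, hB, hB'⟩ := H.boundedDerivs.lipschitz
  obtain ⟨Q, hQ⟩ := exists_nat_gt (max (1 / d) (B / ρ))
  refine ⟨Q, fun q hq hQq α hα => ?_⟩
  have hq0 : (0 : ℝ) < q := by exact_mod_cast hq
  have hqQ : max (1 / d) (B / ρ) < q := hQ.trans_le (by exact_mod_cast hQq)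
  have hqd : 1 / (q : ℝ) ≤ d := by
    have := (le_max_left _ _).trans_lt hqQ
    rw [div_lt_iff₀ hd] at this
    rw [div_le_iff₀ hq0]; linarith
  have hqB : B / q ≤ ρ := by
    have := (le_max_right _ _).trans_lt hqQ
    rw [div_lt_iff₀ hρ] at this
    rw [div_le_iff₀ hq0]; linarith
  set h := G.scale q hq with hh
  set T := H.comp h with hT
  obtain ⟨μ, hμ, hμ'⟩ := T.exists_le_deriv
  obtain ⟨i, p, hip⟩ := exists_int_mul_near hα (1 / (2 * q)) (κ := κ / q) (by positivity)
  refine ⟨i, p, min (μ / (8 * q)) (ε / 2), by positivity, fun φ hφ hφ' x => ?_⟩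
  set η := min (μ / (8 * q)) (ε / 2) with hη
  set j : ℤ := ⌊(q : ℝ) * H.inv x⌋ with hj
  have hhint : ∀ n : ℤ, h.toFun (n / q) = n / q := by
    intro n
    change G.toFun (q * (n / q)) / q = n / q
    rw [mul_div_cancel₀ _ hq0.ne', hGint]
  have hTint : ∀ n : ℤ, T.toFun (n / q) = H.toFun (n / q) := fun n => by
    change H.toFun (h.toFun _) = _
    rw [hhint]
  have hh' : ∀ y, deriv h.toFun y = g (q * y) := by
    intro y
    have h1 : HasDerivAt (fun y : ℝ => q * y) (q : ℝ) y := by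
      simpa using (hasDerivAt_id y).const_mul (q : ℝ)
    have h2 := ((G.differentiable (q * y)).hasDerivAt.comp y h1).div_const (q : ℝ)
    rw [mul_div_assoc, div_self hq0.ne', mul_one] at h2
    exact h2.deriv
  have hT' : ∀ y, deriv T.toFun y = deriv H.toFun (h.toFun y) * g (q * y) := by
    intro y
    rw [← hh']
    exact ((H.differentiable _).hasDerivAt.comp y (h.differentiable y).hasDerivAt).deriv
  have hj1 : (j : ℝ) / q ≤ H.inv x := by
    rw [div_le_iff₀ hq0, mul_comm]; exact Int.floor_le _
  have hj2 : H.inv x ≤ ((j + 1 : ℤ) : ℝ) / q := by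
    rw [le_div_iff₀ hq0, mul_comm]; push_cast; exact (Int.lt_floor_add_one _).le
  set A := H.toFun ((j : ℝ) / q) with hA
  set A' := H.toFun (((j + 1 : ℤ) : ℝ) / q) with hA'
  have hxA : A ≤ x := by
    have := H.strictMono.monotone hj1; rwa [H.right_inv] at this
  have hxA' : x ≤ A' := by
    have := H.strictMono.monotone hj2; rwa [H.right_inv] at this
  have hlen : ((j + 1 : ℤ) : ℝ) / q - j / q = 1 / q := by push_cast; ring
  have hlt : (j : ℝ) / q < ((j + 1 : ℤ) : ℝ) / q := by
    have : 0 < 1 / (q : ℝ) := by positivity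
    linarith
  have hball : Metric.closedBall ((A + A') / 2) ((A' - A) / 2) = Set.Icc A A' := by
    rw [Real.closedBall_eq_Icc]; congr 1 <;> ring
  have hcell : ∀ s, (j : ℝ) / q ≤ s → s ≤ ((j + 1 : ℤ) : ℝ) / q →
      (j : ℝ) / q ≤ h.toFun s ∧ h.toFun s ≤ ((j + 1 : ℤ) : ℝ) / q := by
    intro s h1 h2
    have e1 := h.strictMono.monotone h1
    have e2 := h.strictMono.monotone h2
    rw [hhint] at e1 e2
    exact ⟨e1, e2⟩
  have hAA : A < A' := H.strictMono hlt
  obtain ⟨ξ, hξ, hξ'⟩ := exists_deriv_eq_slope H.toFun hlt H.smooth.continuous.continuousOn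
    H.differentiable.differentiableOn
  set s₁ : ℝ := (j + 1 / 4 - κ) / q with hs₁
  set s₂ : ℝ := (j + 1 / 4 + κ) / q with hs₂
  have hjs₁ : (j : ℝ) / q ≤ s₁ := by
    rw [hs₁]; gcongr; linarith
  have hs₂j : s₂ ≤ ((j + 1 : ℤ) : ℝ) / q := by
    rw [hs₂]; gcongr; push_cast; linarith
  have hs₁₂ : s₁ < s₂ := by
    rw [hs₁, hs₂]; gcongr; linarith
  refine ⟨(A + A') / 2, (A' - A) / 2, T.toFun s₁, T.toFun s₂, by linarith, ?_, ?_, ?_, ?_, ?_⟩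
  · have := hB' ((j : ℝ) / q) (((j + 1 : ℤ) : ℝ) / q)
    rw [hlen, abs_of_pos (by positivity : 0 < 1 / (q : ℝ))] at this
    have h2 := (abs_le.1 this).2
    have h3 : B * (1 / q) = B / q := by ring
    linarith
  · rw [hball]; exact ⟨hxA, hxA'⟩
  · rw [hball]
    refine Set.Icc_subset_Icc ?_ ?_
    · have := T.strictMono.monotone hjs₁; rwa [hTint] at this
    · have := T.strictMono.monotone hs₂j; rwa [hTint] at this
  · have hv : h.toFun s₁ < h.toFun s₂ := h.strictMono hs₁₂
    obtain ⟨ζ, hζ, hζ'⟩ := exists_deriv_eq_slope H.toFun hv H.smooth.continuous.continuousOn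
      H.differentiable.differentiableOn
    have hvlen : μ₀ * (s₂ - s₁) ≤ h.toFun s₂ - h.toFun s₁ :=
      h.le_sub_of_le_deriv (fun y => by rw [hh']; exact hμ₀' _) hs₁₂.le
    have e1 : (j : ℝ) / q ≤ ζ := (hcell s₁ hjs₁ (hs₁₂.le.trans hs₂j)).1.trans hζ.1.le
    have e2 : ζ ≤ ((j + 1 : ℤ) : ℝ) / q := hζ.2.le.trans (hcell s₂ (hjs₁.trans hs₁₂.le) hs₂j).2
    have hr := hd' ξ ζ ((abs_le.2 ⟨by linarith [hξ.2], by linarith [hξ.1]⟩).trans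
      (hlen.le.trans hqd))
    have hξp := H.deriv_pos ξ
    have h12 : deriv H.toFun ξ / 2 ≤ deriv H.toFun ζ := by
      have := (abs_le.1 hr).1
      have h2 : 1 / 2 ≤ deriv H.toFun ζ / deriv H.toFun ξ := by linarith
      rw [le_div_iff₀ hξp] at h2
      linarith
    have hslen : s₂ - s₁ = 2 * κ * (1 / q) := by rw [hs₁, hs₂]; ring
    have hvp : 0 < h.toFun s₂ - h.toFun s₁ := by linarith
    rw [eq_div_iff (by rw [hlen]; positivity), hlen] at hξ'
    rw [eq_div_iff hvp.ne'] at hζ'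
    change _ ≤ H.toFun (h.toFun s₂) - H.toFun (h.toFun s₁)
    rw [← hζ', ← hξ']
    calc μ₀ * κ * (deriv H.toFun ξ * (1 / q) / 2)
        = (deriv H.toFun ξ / 2) * (μ₀ * (κ * (1 / q))) := by ring
      _ ≤ deriv H.toFun ζ * (μ₀ * (s₂ - s₁)) := by
          have : 0 ≤ κ * (1 / q) := by positivity
          rw [hslen]; gcongr <;> linarith [H.deriv_pos ζ]
      _ ≤ deriv H.toFun ζ * (h.toFun s₂ - h.toFun s₁) := by
          have := (H.deriv_pos ζ).le
          gcongr
  · intro y hy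
    set s := T.inv y with hs
    have hTs : T.toFun s = y := T.right_inv y
    have hss₁ : s₁ ≤ s := by
      rw [← T.left_inv s₁]; exact T.inv_strictMono.monotone hy.1
    have hss₂ : s ≤ s₂ := by
      rw [← T.left_inv s₂]; exact T.inv_strictMono.monotone hy.2
    set s' := s + (i * α - p) with hs'
    have hs'p : s + i * α = s' + p := by rw [hs']; ring
    have hqs : |(q : ℝ) * s - j - 1 / 4| ≤ κ := by
      rw [hs₁, div_le_iff₀ hq0] at hss₁
      rw [hs₂, le_div_iff₀ hq0] at hss₂
      rw [abs_le]; constructor <;> linarith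
    have hqs' : |(q : ℝ) * s' - j - 3 / 4| ≤ 2 * κ := by
      have e1 : (q : ℝ) * s' - j - 3 / 4 = (q * s - j - 1 / 4) + q * (i * α - p - 1 / (2 * q)) := by
        rw [hs']; field_simp; ring
      have e2 : |(q : ℝ) * (i * α - p - 1 / (2 * q))| ≤ κ := by
        rw [abs_mul, abs_of_pos hq0]
        calc (q : ℝ) * _ ≤ q * (κ / q) := by gcongr
          _ = κ := by field_simp
      rw [e1]
      exact (abs_add_le _ _).trans (by linarith)
    have hs'1 : j / q + 1 / (8 * q) ≤ s' := by
      have := (abs_le.1 hqs').1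
      have e : (j : ℝ) / q + 1 / (8 * q) = (j + 1 / 8) / q := by field_simp
      rw [e, div_le_iff₀ hq0]; linarith
    have hs'2 : s' + 1 / (8 * q) ≤ ((j + 1 : ℤ) : ℝ) / q := by
      have := (abs_le.1 hqs').2
      have e : ((j + 1 : ℤ) : ℝ) / q = (j + 7 / 8) / q + 1 / (8 * q) := by
        push_cast; field_simp; ring
      have e2 : s' ≤ (j + 7 / 8) / q := by rw [le_div_iff₀ hq0]; linarith
      linarith
    have h8 : 0 < 1 / (8 * (q : ℝ)) := by positivity
    have hconj : T.conj (i * α) y = T.toFun s' + p := by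
      change T.toFun (s + i * α) = _
      rw [hs'p, T.map_add_int]
    have hη1 : η ≤ μ * (1 / (8 * q)) := by
      have := min_le_left (μ / (8 * q)) (ε / 2)
      rw [mul_one_div]; exact this
    have hφy := abs_le.1 (hφ y)
    rw [hconj] at hφy
    constructor
    · rw [hball]
      have m1 := T.le_sub_of_le_deriv hμ' (x := j / q) (y := s') (by linarith)
      have m2 := T.le_sub_of_le_deriv hμ' (x := s') (y := ((j + 1 : ℤ) : ℝ) / q) (by linarith)
      rw [hTint] at m1 m2
      have m3 : μ * (1 / (8 * q)) ≤ μ * (s' - j / q) := by gcongr; linarith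
      have m4 : μ * (1 / (8 * q)) ≤ μ * (((j + 1 : ℤ) : ℝ) / q - s') := by gcongr; linarith
      constructor <;> linarith [hφy.1, hφy.2]
    · rw [deriv_sub_const]
      have hd1 := hφ' y
      rw [← hTs, T.deriv_conj, hs'p, hTs] at hd1
      have hTp : deriv T.toFun (s' + p) = deriv T.toFun s' := by
        have e : (fun z => T.toFun (z + p)) = fun z => T.toFun z + p :=
          funext fun z => T.map_add_int z p
        have := deriv_comp_add_const (f := T.toFun) (p : ℝ) s'
        rw [e, deriv_add_const] at this
        exact this.symm
      have hc1 := hcell s (hjs₁.trans hss₁) (hss₂.trans hs₂j)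
      have hc2 := hcell s' (by linarith) (by linarith)
      have hu := hd' (h.toFun s) (h.toFun s')
        ((abs_le.2 ⟨by linarith, by linarith⟩).trans (hlen.le.trans hqd))
      have hz1 : |((q : ℝ) * s - j) - 1 / 4| ≤ κ := hqs
      have := hratio (q * s - j) (q * s' - j) _ hz1 hqs' hu
      have p1 : g (q * s - j) = g (q * s) := by
        rw [← hgper (q * s - j) j, sub_add_cancel]
      have p2 : g (q * s' - j) = g (q * s') := by
        rw [← hgper (q * s' - j) j, sub_add_cancel]
      rw [p1, p2] at this
      rw [hTp, hT', hT', mul_div_mul_comm] at hd1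
      have hη2 : η ≤ ε / 2 := min_le_right _ _
      have k1 := abs_le.1 hd1
      have k2 := abs_lt.1 this
      rw [abs_lt]
      constructor <;> linarith

end CircleLift

theorem abs_sub_le_of_geometric {a : ℕ → ℝ} {C : ℝ} {N : ℕ} (hC : 0 ≤ C)
    (h : ∀ n ≥ N, |a (n + 1) - a n| ≤ C * (1 / 2) ^ (n + 1)) {n m : ℕ} (hn : N ≤ n) (hm : n ≤ m) :
    |a m - a n| ≤ C * (1 / 2) ^ n := by
  have : |a m - a n| ≤ C * (1 / 2) ^ n - C * (1 / 2) ^ m := by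
    induction m, hm using Nat.le_induction with
    | base => simp
    | succ m hm ih =>
      have h1 := h m (hn.trans hm)
      have h2 := abs_sub_le (a (m + 1)) (a m) (a n)
      rw [pow_succ] at h1 ⊢
      linarith
  have h2 : 0 ≤ C * (1 / 2 : ℝ) ^ m := by positivity
  linarith

theorem exists_smooth_limit {F : ℕ → ℝ → ℝ} (hs : ∀ n, ContDiff ℝ ∞ (F n))
    (h : ∀ k, ∃ N, ∀ n ≥ N, ∀ x,
      |iteratedDeriv k (F (n + 1)) x - iteratedDeriv k (F n) x| ≤ (1 / 2) ^ (n + 1)) :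
    ∃ f, ContDiff ℝ ∞ f ∧
      ∀ k, TendstoUniformly (fun n => iteratedDeriv k (F n)) (iteratedDeriv k f) atTop := by
  have hlim : ∀ k, ∃ g, TendstoUniformly (fun n => iteratedDeriv k (F n)) g atTop := by
    intro k
    obtain ⟨N, hN⟩ := h k
    have hb : ∀ x n m, N ≤ n → n ≤ m →
        |iteratedDeriv k (F m) x - iteratedDeriv k (F n) x| ≤ (1 / 2) ^ n := by
      intro x n m hn hm
      have := abs_sub_le_of_geometric (a := fun n => iteratedDeriv k (F n) x) zero_le_one
        (fun n hn => by simpa using hN n hn x) hn hm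
      simpa using this
    have hpt : ∀ x, ∃ y, Tendsto (fun n => iteratedDeriv k (F n) x) atTop (𝓝 y) := by
      intro x
      refine cauchySeq_tendsto_of_complete (Metric.cauchySeq_iff'.2 fun ε hε => ?_)
      obtain ⟨n, hn⟩ := exists_pow_lt_of_lt_one hε (by norm_num : (1 / 2 : ℝ) < 1)
      refine ⟨max n N, fun m hm => ?_⟩
      rw [Real.dist_eq]
      refine (hb x _ m (le_max_right _ _) hm).trans_lt (lt_of_le_of_lt ?_ hn)
      exact pow_le_pow_of_le_one (by norm_num) (by norm_num) (le_max_left _ _)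
    choose g hg using hpt
    refine ⟨g, Metric.tendstoUniformly_iff.2 fun ε hε => ?_⟩
    obtain ⟨n, hn⟩ := exists_pow_lt_of_lt_one hε (by norm_num : (1 / 2 : ℝ) < 1)
    filter_upwards [eventually_ge_atTop (max n N)] with m hm x
    rw [Real.dist_eq]
    have h1 : |g x - iteratedDeriv k (F m) x| ≤ (1 / 2) ^ m := by
      refine le_of_tendsto ((hg x).sub_const _).abs ?_
      filter_upwards [eventually_ge_atTop m] with l hl
      exact hb x m l ((le_max_right _ _).trans hm) hl
    refine h1.trans_lt (lt_of_le_of_lt ?_ hn)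
    exact pow_le_pow_of_le_one (by norm_num) (by norm_num) ((le_max_left _ _).trans hm)
  choose g hg using hlim
  have hder : ∀ k x, HasDerivAt (g k) (g (k + 1) x) x := by
    intro k
    refine hasDerivAt_of_tendstoUniformly (hg (k + 1)) (Eventually.of_forall fun n x => ?_)
      fun x => (hg k).tendsto_at x
    rw [iteratedDeriv_succ]
    exact ((hs n).of_infty (k + 1)).differentiable_iteratedDeriv k
      (by exact_mod_cast k.lt_succ_self) x |>.hasDerivAt
  have hit : ∀ k, iteratedDeriv k (g 0) = g k := by
    intro k
    induction k with
    | zero => exact iteratedDeriv_zero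
    | succ k ih =>
      rw [iteratedDeriv_succ, ih]
      exact funext fun x => (hder k x).deriv
  refine ⟨g 0, contDiff_of_differentiable_iteratedDeriv fun m _ => ?_, fun k => ?_⟩
  · rw [hit]; exact fun x => (hder m x).differentiableAt
  · rw [hit]; exact hg k

theorem HasGoodCells.mono {φ : ℝ → ℝ} {t ε c ρ ρ' : ℝ} (h : HasGoodCells φ t ε c ρ)
    (hρ : ρ ≤ ρ') : HasGoodCells φ t ε c ρ' := fun x => by
  obtain ⟨w, δ, u, v, h1, h2, h3⟩ := h x
  exact ⟨w, δ, u, v, h1, h2.trans hρ, h3⟩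

/-- The data carried along the inductive construction: the current conjugacy, the range of iterates
which are to be controlled from now on, and the tolerance. -/
structure Stage where
  lift : CircleLift
  range : ℕ
  tol : ℝ
  tol_pos : 0 < tol

/-- The `n`-th step of the inductive construction. -/
structure Stage.Step (α : ℝ) (r n : ℕ) (t ε c : ℝ) (s s' : Stage) : Prop where
  close : ∀ i : ℤ, |i| ≤ s.range → DerivBound (n + r + 1) (s.tol * (1 / 2) ^ (n + 1))
    (fun x => s'.lift.conj (i * α) x - s.lift.conj (i * α) x)
  tol_le : s'.tol ≤ s.tol
  range_le : s.range ≤ s'.range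
  le_range : n + 1 ≤ s'.range
  good : ∃ i p : ℤ, |i| ≤ s'.range ∧ ∀ φ : ℝ → ℝ,
    (∀ x, |φ x - s'.lift.conj (i * α) x| ≤ s'.tol) →
    (∀ x, |deriv φ x - deriv (s'.lift.conj (i * α)) x| ≤ s'.tol) →
    HasGoodCells (fun x => φ x - p) t ε c (1 / (n + 1))

theorem Stage.exists_step {α : ℝ} (hα : Irrational α) (A : LiouvilleApprox α) {t ε : ℝ}
    (ht : 0 < t) (hε : 0 < ε) : ∃ c > 0, ∀ (r n : ℕ) (s : Stage),
      ∃ s', Stage.Step α r n t ε c s s' := by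
  obtain ⟨G, c, hc, hG⟩ := CircleLift.exists_cosLift_goodCells ht hε
  refine ⟨c, hc, fun r n s => ?_⟩
  obtain ⟨Q, hQ⟩ := hG s.lift (1 / (n + 1)) (by positivity)
  have hev : ∀ᶠ m in atTop, ∀ i ∈ Set.Icc (-(s.range : ℤ)) s.range,
      DerivBound (n + r + 1) (s.tol * (1 / 2) ^ (n + 1))
        (fun x => (s.lift.comp (G.scale (A.den m) (A.den_pos m))).conj (i * α) x
          - s.lift.conj (i * α) x) :=
    (Set.finite_Icc _ _).eventually_all.2 fun i _ =>
      s.lift.eventually_derivBound_conj_sub A G _ i (mul_pos s.tol_pos (by positivity))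
  obtain ⟨m, hm, hmQ⟩ := (hev.and (eventually_ge_atTop Q)).exists
  obtain ⟨i, p, η, hη, hgood⟩ := hQ (A.den m) (A.den_pos m) (hmQ.trans (A.le_den m)) α hα
  refine ⟨⟨s.lift.comp (G.scale (A.den m) (A.den_pos m)), max s.range (max (n + 1) i.natAbs),
    min s.tol η, lt_min s.tol_pos hη⟩, ?_, min_le_left _ _, le_max_left _ _,
    (le_max_left _ _).trans (le_max_right _ _), i, p, ?_, ?_⟩
  · intro i hi
    exact hm i (abs_le.1 hi)
  · rw [Int.abs_eq_natAbs]
    exact_mod_cast (le_max_right _ _).trans (le_max_right _ _)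
  · intro φ h1 h2
    exact hgood φ (fun x => (h1 x).trans (min_le_right _ _))
      fun x => (h2 x).trans (min_le_right _ _)

theorem exists_iterates {α : ℝ} (hL : Liouville α) (r : ℕ) {η : ℝ} (hη : 0 < η) :
    ∃ F : ℤ → ℝ → ℝ, (∀ i, ContDiff ℝ ∞ (F i)) ∧ (∀ i x, F i (x + 1) = F i x + 1) ∧
      (∀ x, F 0 x = x) ∧ (∀ i j x, F i (F j x) = F (i + j) x) ∧ (∀ i, Monotone (F i)) ∧
      (∀ i, |F i 0 - i * α| ≤ 1) ∧
      (∀ i : ℤ, |i| ≤ 1 → DerivBound r η (fun x => F i x - (x + i * α))) ∧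
      ∀ t ε : ℚ, 0 < t → 0 < ε → ∃ c > 0, ∀ ρ > 0, ∃ i p : ℤ,
        HasGoodCells (fun x => F i x - p) t ε c ρ := by
  obtain ⟨A⟩ := hL.nonempty_approx
  have hα := hL.irrational
  let S := {s : ℚ × ℚ // 0 < s.1 ∧ 0 < s.2}
  have : Nonempty S := ⟨⟨(1, 1), one_pos, one_pos⟩⟩
  obtain ⟨σ, hσ⟩ := exists_surjective_nat S
  have hstep := fun s : S => Stage.exists_step hα A (t := s.1.1) (ε := s.1.2)
    (by exact_mod_cast s.2.1) (by exact_mod_cast s.2.2)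
  choose c hc hstep using hstep
  choose nxt hnxt using hstep
  let start : Stage := ⟨CircleLift.refl, 1, min η 1, lt_min hη one_pos⟩
  let st : ℕ → Stage := fun n => Nat.rec start (fun n s => nxt (σ n.unpair.1) r n s) n
  have hst : ∀ n, Stage.Step α r n (σ n.unpair.1).1.1 (σ n.unpair.1).1.2 (c (σ n.unpair.1))
      (st n) (st (n + 1)) := fun n => hnxt _ _ _ _
  have htol : Antitone fun n => (st n).tol := antitone_nat_of_succ_le fun n => (hst n).tol_le
  have hrange : Monotone fun n => (st n).range := monotone_nat_of_le_succ fun n => (hst n).range_le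
  have hdiff : ∀ (i : ℤ) (N k : ℕ), |i| ≤ (st N).range → k ≤ N + r + 1 → ∀ n ≥ N, ∀ x,
      |iteratedDeriv k ((st (n + 1)).lift.conj (i * α)) x
        - iteratedDeriv k ((st n).lift.conj (i * α)) x| ≤ (st N).tol * (1 / 2) ^ (n + 1) := by
    intro i N k hi hk n hn x
    have h1 := (hst n).close i (hi.trans (by exact_mod_cast hrange hn)) k (by omega) x
    rw [iteratedDeriv_fun_sub (((st (n + 1)).lift.conj_smooth _).of_infty k).contDiffAt
      (((st n).lift.conj_smooth _).of_infty k).contDiffAt] at h1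
    refine h1.trans ?_
    gcongr
    exact htol hn
  have hlim : ∀ i : ℤ, ∃ f, ContDiff ℝ ∞ f ∧ ∀ k, TendstoUniformly
      (fun n => iteratedDeriv k ((st n).lift.conj (i * α))) (iteratedDeriv k f) atTop := by
    intro i
    refine exists_smooth_limit (fun n => (st n).lift.conj_smooth _) fun k => ?_
    refine ⟨max (i.natAbs + 1) k, fun n hn x => ?_⟩
    have hnk : k ≤ n := (le_max_right _ _).trans hn
    have hni : i.natAbs + 1 ≤ n := (le_max_left _ _).trans hn
    obtain ⟨n', rfl⟩ : ∃ n', n = n' + 1 := ⟨n - 1, by omega⟩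
    have h1 := (hst n').le_range
    have h2 := hdiff i (n' + 1) k (by rw [Int.abs_eq_natAbs]; exact_mod_cast by omega)
      (by omega) (n' + 1) le_rfl x
    refine h2.trans (mul_le_of_le_one_left (by positivity) ?_)
    have h3 : (st (n' + 1)).tol ≤ (st 0).tol := htol (Nat.zero_le (n' + 1))
    exact h3.trans (min_le_right _ _)
  choose F hFs hF using hlim
  have hpt : ∀ (i : ℤ) x, Tendsto (fun n => (st n).lift.conj (i * α) x) atTop (𝓝 (F i x)) := by
    intro i x
    simpa using (hF i 0).tendsto_at x
  have hclose : ∀ (i : ℤ) (N k : ℕ), |i| ≤ (st N).range → k ≤ N + r + 1 → ∀ x,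
      |iteratedDeriv k (F i) x - iteratedDeriv k ((st N).lift.conj (i * α)) x| ≤ (st N).tol := by
    intro i N k hi hk x
    refine le_of_tendsto (((hF i k).tendsto_at x).sub_const _).abs ?_
    filter_upwards [eventually_ge_atTop N] with m hm
    refine (abs_sub_le_of_geometric (a := fun n => iteratedDeriv k ((st n).lift.conj (i * α)) x)
      (st N).tol_pos.le (fun n hn => hdiff i N k hi hk n hn x) le_rfl hm).trans ?_
    exact mul_le_of_le_one_right (st N).tol_pos.le (pow_le_one₀ (by norm_num) (by norm_num))
  refine ⟨F, hFs, ?_, ?_, ?_, ?_, ?_, ?_, ?_⟩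
  · intro i x
    refine tendsto_nhds_unique (hpt i (x + 1)) ?_
    simp only [CircleLift.conj_add_one]
    exact (hpt i x).add_const 1
  · intro x
    refine tendsto_nhds_unique (hpt 0 x) ?_
    simp [CircleLift.conj_zero]
  · intro i j x
    have h1 : Tendsto (fun n => (st n).lift.conj (i * α) ((st n).lift.conj (j * α) x)) atTop
        (𝓝 (F i (F j x))) := by
      have := hF i 0
      simp only [iteratedDeriv_zero] at this
      exact this.tendsto_comp (hFs i).continuous.continuousAt (hpt j x)
    refine tendsto_nhds_unique h1 ?_
    have := hpt (i + j) x
    simp only [CircleLift.conj_conj]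
    convert this using 3
    push_cast; ring
  · intro i x y hxy
    exact le_of_tendsto_of_tendsto' (hpt i x) (hpt i y)
      fun n => ((st n).lift.conj_strictMono _).monotone hxy
  · intro i
    exact le_of_tendsto' ((hpt i 0).sub_const _).abs fun n => (st n).lift.abs_conj_sub_le _
  · intro i hi k hk x
    have h1 := hclose i 0 k (by exact_mod_cast hi) (by omega) x
    have hs0 : ContDiff ℝ ∞ fun x : ℝ => x + i * α := contDiff_id.add contDiff_const
    rw [iteratedDeriv_fun_sub ((hFs i).of_infty k).contDiffAt (hs0.of_infty k).contDiffAt]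
    exact h1.trans (min_le_left _ _)
  · intro t ε ht hε
    obtain ⟨k, hk⟩ := hσ ⟨(t, ε), ht, hε⟩
    refine ⟨c (σ k), hc _, fun ρ hρ => ?_⟩
    obtain ⟨m, hm⟩ := exists_nat_one_div_lt hρ
    have hmn : m ≤ Nat.pair k m := Nat.right_le_pair k m
    obtain ⟨i, p, hi, hgood⟩ := (hst (Nat.pair k m)).good
    rw [Nat.unpair_pair, hk] at hgood
    refine ⟨i, p, ?_⟩
    have h0 := hclose i (Nat.pair k m + 1) 0 hi (by omega)
    have h1 := hclose i (Nat.pair k m + 1) 1 hi (by omega)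
    simp only [iteratedDeriv_zero, iteratedDeriv_one] at h0 h1
    rw [hk]
    refine (hgood (F i) h0 h1).mono (le_trans ?_ hm.le)
    gcongr

/-- If most of a cell lies in `A` and `φ` maps a proportion of the cell back into it with derivative
close to `t`, then a positive proportion of the cell lies in `A` and is mapped back into `A`. -/
theorem volume_return_pos {φ : ℝ → ℝ} (hφ : Differentiable ℝ φ) (hinj : Function.Injective φ)
    {t ε c κ w δ u v : ℝ} (ht : 0 < t) (hε : ε ≤ t / 2) (hκ : 0 ≤ κ) (hδ : 0 < δ)
    (hκc : κ * (1 + 2 / t) < c) {A : Set ℝ} (hA : MeasurableSet A)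
    (hsub : Set.Icc u v ⊆ Metric.closedBall w δ) (huv : c * δ ≤ v - u)
    (hret : ∀ y ∈ Set.Icc u v, φ y ∈ Metric.closedBall w δ ∧ |deriv φ y - t| < ε)
    (hdense : volume (Metric.closedBall w δ \ A) ≤ ENNReal.ofReal (κ * δ)) :
    0 < volume {y | y ∈ A ∧ φ y ∈ A ∧ |deriv φ y - t| < ε} := by
  set E := Set.Icc u v ∩ φ ⁻¹' Aᶜ with hE
  have hEm : MeasurableSet E := measurableSet_Icc.inter (hφ.continuous.measurable hA.compl)
  have hvolE : volume E ≤ ENNReal.ofReal (κ * δ * (2 / t)) := by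
    have h1 := lintegral_image_eq_lintegral_abs_deriv_mul (f' := deriv φ) hEm
      (fun x _ => (hφ x).hasDerivAt.hasDerivWithinAt) hinj.injOn fun _ => 1
    simp only [setLIntegral_one, mul_one] at h1
    have h2 : volume (φ '' E) ≤ ENNReal.ofReal (κ * δ) := by
      refine (measure_mono ?_).trans hdense
      rintro _ ⟨y, hy, rfl⟩
      exact ⟨(hret y hy.1).1, hy.2⟩
    have h3 : ENNReal.ofReal (t / 2) * volume E ≤ ENNReal.ofReal (κ * δ) := by
      rw [h1] at h2
      refine le_trans ?_ h2
      rw [← setLIntegral_const]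
      refine setLIntegral_mono' hEm fun y hy => ENNReal.ofReal_le_ofReal ?_
      have := abs_lt.1 (hret y hy.1).2
      exact le_trans (by linarith) (le_abs_self _)
    have h4 : ENNReal.ofReal (2 / t) * (ENNReal.ofReal (t / 2) * volume E) = volume E := by
      rw [← mul_assoc, ← ENNReal.ofReal_mul (by positivity)]
      simp [ht.ne']
    rw [← h4, mul_comm (κ * δ), ENNReal.ofReal_mul (by positivity)]
    gcongr
  have hcover : Set.Icc u v ⊆ {y | y ∈ A ∧ φ y ∈ A ∧ |deriv φ y - t| < ε} ∪
      ((Metric.closedBall w δ \ A) ∪ E) := by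
    intro y hy
    by_cases hyA : y ∈ A
    · by_cases hφA : φ y ∈ A
      · exact Or.inl ⟨hyA, hφA, (hret y hy).2⟩
      · exact Or.inr (Or.inr ⟨hy, hφA⟩)
    · exact Or.inr (Or.inl ⟨hsub hy, hyA⟩)
  rw [pos_iff_ne_zero]
  intro h0
  have h1 : ENNReal.ofReal (c * δ) ≤ ENNReal.ofReal (κ * δ + κ * δ * (2 / t)) := calc
    _ ≤ volume (Set.Icc u v) := by
      rw [Real.volume_Icc]; exact ENNReal.ofReal_le_ofReal huv
    _ ≤ 0 + (volume (Metric.closedBall w δ \ A) + volume E) := by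
      refine (measure_mono hcover).trans ((measure_union_le _ _).trans ?_)
      rw [h0]
      gcongr
      exact measure_union_le _ _
    _ ≤ _ := by
      rw [zero_add, ENNReal.ofReal_add (by positivity) (by positivity)]
      gcongr
  rw [ENNReal.ofReal_le_ofReal_iff (by positivity)] at h1
  nlinarith

theorem exists_return_of_goodCells {F : ℤ → ℝ → ℝ} (hF : ∀ i, Differentiable ℝ (F i))
    (hinj : ∀ i, Function.Injective (F i)) {t ε c : ℝ} (ht : 0 < t) (hε : ε ≤ t / 2) (hc : 0 < c)
    (hgood : ∀ ρ > 0, ∃ i p : ℤ, HasGoodCells (fun x => F i x - p) t ε c ρ)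
    {A : Set ℝ} (hA : MeasurableSet A) (hper : ∀ (x : ℝ) (p : ℤ), x - p ∈ A ↔ x ∈ A)
    (hpos : volume A ≠ 0) :
    ∃ i, 0 < volume {y | y ∈ A ∧ F i y ∈ A ∧ |deriv (F i) y - t| < ε} := by
  choose i p hip using fun m : ℕ => hgood (1 / (m + 1)) (by positivity)
  have hdens := IsUnifLocDoublingMeasure.ae_tendsto_measure_inter_div (volume : Measure ℝ) A 1
  have : (ae (volume.restrict A)).NeBot := by
    rw [ae_neBot, Ne, Measure.restrict_eq_zero]; exact hpos
  obtain ⟨x, hx⟩ := hdens.exists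
  choose w δ u v hδ hδm hxw hsub huv hret using fun m => hip m x
  have hδlim : Tendsto δ atTop (𝓝[>] 0) := by
    refine tendsto_nhdsWithin_iff.2 ⟨?_, Eventually.of_forall hδ⟩
    exact squeeze_zero (fun m => (hδ m).le) hδm tendsto_one_div_add_atTop_nhds_zero_nat
  have hlim := hx w δ hδlim (Eventually.of_forall fun m => by simpa using hxw m)
  obtain ⟨κ, hκ0, hκ1, hκc⟩ : ∃ κ > 0, κ < 1 ∧ κ * (1 + 2 / t) < c := by
    have h : (0 : ℝ) < 1 + 2 / t := by positivity
    refine ⟨min (1 / 2) (c / (1 + 2 / t) / 2), by positivity,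
      (min_le_left _ _).trans_lt (by norm_num), ?_⟩
    refine lt_of_le_of_lt (mul_le_mul_of_nonneg_right (min_le_right _ _) h.le) ?_
    rw [div_right_comm, div_mul_cancel₀ _ h.ne']
    linarith
  have hlt : ENNReal.ofReal (1 - κ / 2) < 1 := by
    rw [ENNReal.ofReal_lt_one]; linarith
  obtain ⟨m, hm⟩ := (hlim.eventually_const_lt hlt).exists
  have hvol : volume (Metric.closedBall (w m) (δ m) \ A) ≤ ENNReal.ofReal (κ * δ m) := by
    have h2δ : 0 < 2 * δ m := by linarith [hδ m]
    rw [Real.volume_closedBall, ENNReal.lt_div_iff_mul_lt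
      (Or.inl (ENNReal.ofReal_pos.2 h2δ).ne') (Or.inl ENNReal.ofReal_ne_top),
      ← ENNReal.ofReal_mul (by linarith)] at hm
    have h1 := measure_inter_add_sdiff (μ := volume) (Metric.closedBall (w m) (δ m)) hA
    rw [Set.inter_comm, Real.volume_closedBall] at h1
    rw [show (2 * δ m) = (1 - κ / 2) * (2 * δ m) + κ * δ m by ring,
      ENNReal.ofReal_add (mul_nonneg (by linarith) h2δ.le) (mul_pos hκ0 (hδ m)).le] at h1
    by_contra! h2
    exact (ENNReal.add_lt_add hm h2).ne' h1
  refine ⟨i m, ?_⟩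
  have hd : ∀ y, deriv (fun x => F (i m) x - p m) y = deriv (F (i m)) y :=
    fun y => deriv_sub_const _
  have := volume_return_pos (φ := fun x => F (i m) x - p m) ((hF _).sub_const _)
    (fun a b hab => hinj _ (sub_left_injective hab)) ht hε hκ0.le (hδ m) hκc hA (hsub m) (huv m)
    (hret m) hvol
  simpa only [hper, hd] using this

theorem AddCircle.volume_eq_zero_iff_preimage {B : Set UnitAddCircle} (hB : MeasurableSet B) :
    volume B = 0 ↔ volume ((fun x : ℝ => (x : UnitAddCircle)) ⁻¹' B) = 0 := by
  have hmp := fun a : ℝ => AddCircle.measurePreserving_mk 1 a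
  have hpre : MeasurableSet ((fun x : ℝ => (x : UnitAddCircle)) ⁻¹' B) :=
    (AddCircle.continuous_mk' 1).measurable hB
  constructor
  · intro h
    rw [← Set.inter_univ (_ ⁻¹' B), ← iUnion_Ioc_intCast ℝ, Set.inter_iUnion,
      measure_iUnion_null_iff]
    intro k
    rw [← Measure.restrict_apply hpre]
    exact ((hmp k).measure_preimage hB.nullMeasurableSet).trans h
  · intro h
    rw [← (hmp 0).measure_preimage hB.nullMeasurableSet, Measure.restrict_apply hpre]
    exact measure_mono_null Set.inter_subset_left h

theorem invFun_eq_of_iterates {F : ℤ → ℝ → ℝ} (h0 : ∀ x, F 0 x = x)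
    (hadd : ∀ i j x, F i (F j x) = F (i + j) x) : Function.invFun (F 1) = F (-1) :=
  Function.invFun_eq_of_injective_of_rightInverse
    (Function.LeftInverse.injective (g := F (-1)) fun x => by simp [hadd, h0])
    fun x => by simp [hadd, h0]

theorem iterate_eq_of_iterates {F : ℤ → ℝ → ℝ} (h0 : ∀ x, F 0 x = x)
    (hadd : ∀ i j x, F i (F j x) = F (i + j) x) (i : ℤ) (n : ℕ) : (F i)^[n] = F (n * i) := by
  induction n with
  | zero => funext x; simp [h0]
  | succ n ih =>
    funext x
    rw [Function.iterate_succ_apply', ih, hadd]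
    push_cast
    ring_nf

theorem zpowLift_eq_of_iterates {F : ℤ → ℝ → ℝ} (h0 : ∀ x, F 0 x = x)
    (hadd : ∀ i j x, F i (F j x) = F (i + j) x) (i : ℤ) : zpowLift (F 1) i = F i := by
  unfold zpowLift
  split_ifs with hi
  · rw [iterate_eq_of_iterates h0 hadd, Int.toNat_of_nonneg hi, mul_one]
  · rw [invFun_eq_of_iterates h0 hadd, iterate_eq_of_iterates h0 hadd,
      Int.toNat_of_nonneg (by omega), neg_mul_neg, mul_one]

theorem ratioSet_eq_Ici {F : ℤ → ℝ → ℝ} (hF : ∀ i, ContDiff ℝ ∞ (F i))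
    (hinj : ∀ i, Function.Injective (F i))
    (hgood : ∀ t ε : ℚ, 0 < t → 0 < ε → ∃ c > 0, ∀ ρ > 0, ∃ i p : ℤ,
      HasGoodCells (fun x => F i x - p) t ε c ρ)
    {Fz : ℤ → UnitAddCircle → UnitAddCircle} {D : ℤ → UnitAddCircle → ℝ}
    (hFz : ∀ i, ∀ x : ℝ, Fz i x = F i x) (hD : ∀ i, ∀ x : ℝ, D i x = deriv (F i) x) :
    ratioSet Fz D = Set.Ici 0 := by
  refine Set.Subset.antisymm (fun t ht => ht.1) fun t ht => ⟨ht, fun A hA hApos ε hε => ?_⟩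
  have hq : IsQuotientMap (fun x : ℝ => (x : UnitAddCircle)) := isQuotientMap_quotient_mk'
  have hFzm : ∀ i, Measurable (Fz i) := fun i => by
    refine (hq.continuous_iff.2 ?_).measurable
    exact ((AddCircle.continuous_mk' 1).comp (hF i).continuous).congr fun x => (hFz i x).symm
  have hDm : ∀ i, Measurable (D i) := fun i => by
    refine (hq.continuous_iff.2 ?_).measurable
    exact (hF i).deriv_infty.continuous.congr fun x => (hD i x).symm
  obtain ⟨t', ht1, ht2⟩ := exists_rat_btwn (show t < t + ε / 2 by linarith)
  have ht' : (0 : ℝ) < t' := lt_of_le_of_lt ht ht1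
  obtain ⟨ε', hε0, hε1⟩ := exists_rat_btwn (show 0 < min (ε / 2) (t' / 2) by positivity)
  obtain ⟨c, hc, hcell⟩ := hgood t' ε' (by exact_mod_cast ht') (by exact_mod_cast hε0)
  obtain ⟨i, hi⟩ := exists_return_of_goodCells (fun i => (hF i).differentiable_infty) hinj ht'
    (hε1.le.trans (min_le_right _ _)) hc hcell (A := (fun x : ℝ => (x : UnitAddCircle)) ⁻¹' A)
    ((AddCircle.continuous_mk' 1).measurable hA)
    (fun x p => by
      have : ((x - p : ℝ) : UnitAddCircle) = x := by
        rw [AddCircle.coe_sub, sub_eq_self, AddCircle.coe_eq_zero_iff]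
        exact ⟨p, by simp⟩
      simp [Set.mem_preimage, this])
    ((AddCircle.volume_eq_zero_iff_preimage hA).not.1 hApos.ne')
  have hB : MeasurableSet {x | x ∈ A ∧ Fz i x ∈ A ∧ |D i x - t'| < ε'} :=
    hA.inter ((hFzm i hA).inter (measurableSet_lt ((hDm i).sub_const _).abs measurable_const))
  refine ⟨_, hB, fun x hx => hx.1, ?_, i, ?_, fun x hx => ?_⟩
  · rw [pos_iff_ne_zero, Ne, AddCircle.volume_eq_zero_iff_preimage hB]
    have hset : (fun x : ℝ => (x : UnitAddCircle)) ⁻¹' {x | x ∈ A ∧ Fz i x ∈ A ∧ |D i x - t'| < ε'} =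
        {y : ℝ | (y : UnitAddCircle) ∈ A ∧ (F i y : UnitAddCircle) ∈ A ∧
          |deriv (F i) y - t'| < ε'} := by
      ext y
      simp only [Set.mem_preimage, Set.mem_ofPred_eq, hFz, hD]
    rw [hset]
    exact hi.ne'
  · rintro _ ⟨x, hx, rfl⟩
    exact hx.2.1
  · calc |D i x - t| = |(D i x - t') + (t' - t)| := by ring_nf
      _ ≤ |D i x - t'| + |(t' : ℝ) - t| := abs_add_le _ _
      _ < ε / 2 + ε / 2 := by
        refine add_lt_add (hx.2.2.trans (hε1.trans_le (min_le_left _ _))) ?_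
        rw [abs_of_pos (by linarith)]; linarith
      _ = ε := by ring

theorem DerivBound.crNorm_le {r : ℕ} {M : ℝ} {φ : ℝ → ℝ} (h : DerivBound r M φ) :
    CrNorm r φ ≤ M :=
  Finset.sup'_le _ _ fun k hk => ciSup_le fun x => h k (by simpa [Nat.lt_succ_iff] using hk) x

theorem invFun_rotLift (α : ℝ) : Function.invFun (RotLift α) = fun x => x - α :=
  Function.invFun_eq_of_injective_of_rightInverse (add_left_injective α)
    fun x => sub_add_cancel x α

/-- For a Liouville number `α ∈ (0,1)` and any `r`, there is a type `III_∞` smooth circle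
diffeomorphism with rotation number `α` whose lift is `2^{-r}`-close to `R_α` in `d_r`. -/
theorem stmt_7 (α : ℝ) (hα0 : 0 < α) (hα1 : α < 1) (hL : Liouville α) (r : ℕ) :
    ∃ f : ℝ → ℝ, IsCircleDiffeoLift f ∧ HasRotationNumber f α ∧
      liftDist r f (RotLift α) < ((2 : ℝ) ^ r)⁻¹ ∧
      ∃ Fz : ℤ → UnitAddCircle → UnitAddCircle, ∃ D : ℤ → UnitAddCircle → ℝ,
        (∀ i : ℤ, ∀ x : ℝ, Fz i ↑x = ↑(zpowLift f i x)) ∧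
        (∀ i : ℤ, ∀ x : ℝ, D i ↑x = deriv (zpowLift f i) x) ∧
        ratioSet Fz D = Set.Ici (0 : ℝ) := by
  have hr : (0 : ℝ) < ((2 : ℝ) ^ r)⁻¹ := by positivity
  obtain ⟨F, hF, hper, h0, hadd, hmono, hrot, hbound, hgood⟩ :=
    exists_iterates hL r (half_pos hr)
  have hinj : ∀ i, Function.Injective (F i) := fun i =>
    Function.LeftInverse.injective (g := F (-i)) fun x => by simp [hadd, h0]
  have hderper : ∀ i x, deriv (F i) (x + 1) = deriv (F i) x := fun i x => by
    rw [← deriv_comp_add_const, funext (hper i), deriv_add_const]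
  refine ⟨F 1, ⟨hF 1, hper 1, fun x => ?_⟩, ⟨0, ?_⟩, ?_,
    fun i => Function.Periodic.lift (f := fun x : ℝ => (F i x : UnitAddCircle)) (c := 1)
      fun x => by simp [hper],
    fun i => Function.Periodic.lift (hderper i), ?_, ?_, ?_⟩
  · refine lt_of_le_of_ne (hmono 1).deriv_nonneg fun h => ?_
    have hc := ((hF (-1)).differentiable_infty (F 1 x)).hasDerivAt.comp x
      ((hF 1).differentiable_infty x).hasDerivAt
    rw [← h, mul_zero, show F (-1) ∘ F 1 = id from funext fun y => by simp [hadd, h0]] at hc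
    exact zero_ne_one (hc.unique (hasDerivAt_id x))
  · rw [Int.cast_zero, add_zero, tendsto_iff_norm_sub_tendsto_zero]
    refine squeeze_zero' (Eventually.of_forall fun n => norm_nonneg _) ?_
      tendsto_one_div_atTop_nhds_zero_nat
    filter_upwards [eventually_gt_atTop 0] with n hn
    have hn' : (0 : ℝ) < n := by exact_mod_cast hn
    rw [iterate_eq_of_iterates h0 hadd, mul_one, Real.norm_eq_abs, le_div_iff₀ hn',
      ← abs_of_pos hn', ← abs_mul, abs_of_pos hn', sub_mul, div_mul_cancel₀ _ hn'.ne', mul_comm α]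
    exact_mod_cast hrot n
  · refine lt_of_le_of_lt (max_le (DerivBound.crNorm_le ?_) (DerivBound.crNorm_le ?_))
      (half_lt_self hr)
    · simpa [RotLift] using hbound 1 (by simp)
    · rw [invFun_eq_of_iterates h0 hadd, invFun_rotLift]
      simpa [sub_eq_add_neg] using hbound (-1) (by simp)
  · intro i x
    rw [zpowLift_eq_of_iterates h0 hadd]
    rfl
  · intro i x
    rw [zpowLift_eq_of_iterates h0 hadd]
    rfl
  · exact ratioSet_eq_Ici hF hinj hgood (fun i x => rfl) fun i x => rfl
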